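/- arXiv:2007.15384 — 7 statements merged into one kernel-verified Lean document; each statement's English description precedes it below -/
import Mathlib

section
/- Projection lemma for a unitary self-dual bivector (Lemma 4.1). For every observer u: (i) e^a e_a − b^a b_a = 1 and e^a b_a = 0, so e^a e_a ≥ 1; (ii) P^a_b u^b = (e^c e_c)u^a + ε^a{}_{bcd}u^d e^b b^c; (iii) consequently η(Pu, Pu) = −e^c e_c and η(Pu, u) = −e^c e_c < 0, the vector u_Σ := Pu/√(e^c e_c) satisfies η(u_Σ,u_Σ) = −1, (u_Σ)₀·u₀ > 0 and P u_Σ = u_Σ, and u_Σ = √(e^c e_c)·(u + ν) with relative velocity ν^a = ε^a{}_{bcd}u^d e^b b^c/(e^c e_c). Thus the observer lying along the orthogonal projection of u onto the blade Σ of U is reached from u by a boost in the direction of the vector product of e and b. -/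
open scoped BigOperators

noncomputable section

/-- Entries of the Minkowski metric diag(-1,1,1,1). -/
def ηd (a : Fin 4) : ℝ := if a = 0 then -1 else 1

/-- Minkowski inner product on ℝ⁴. -/
def mink (x y : Fin 4 → ℝ) : ℝ := ∑ a, ηd a * x a * y a

/-- An observer: unit timelike future-pointing vector. -/
def IsObserver (u : Fin 4 → ℝ) : Prop := mink u u = -1 ∧ 0 < u 0

/-- Totally antisymmetric Levi-Civita symbol with ε₀₁₂₃ = -1. -/
def lev (a b c d : Fin 4) : ℝ :=
  -(((b.val : ℝ) - a.val) * ((c.val : ℝ) - a.val) * ((d.val : ℝ) - a.val) *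
    ((c.val : ℝ) - b.val) * ((d.val : ℝ) - b.val) * ((d.val : ℝ) - c.val)) / 12

/-- Hodge dual ⋆U_{ab} = ½ ε_{abcd} U^{cd} of a 2-form. -/
def hodge (U : Fin 4 → Fin 4 → ℝ) (a b : Fin 4) : ℝ :=
  (1/2) * ∑ c, ∑ d, lev a b c d * ηd c * ηd d * U c d

theorem ηd_zero : ηd 0 = -1 := by simp [ηd]
theorem ηd_one : ηd 1 = 1 := by simp [ηd]
theorem ηd_two : ηd 2 = 1 := by simp [ηd]
theorem ηd_three : ηd 3 = 1 := by simp [ηd]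

/-- Antisymmetric matrix with the six given entries. -/
theorem antisymm_entries (U : Fin 4 → Fin 4 → ℝ) (hUa : ∀ a b, U a b = - U b a) :
    U 0 0 = 0 ∧ U 1 1 = 0 ∧ U 2 2 = 0 ∧ U 3 3 = 0 ∧ U 1 0 = - U 0 1 ∧ U 2 0 = - U 0 2 ∧
    U 3 0 = - U 0 3 ∧ U 2 1 = - U 1 2 ∧ U 3 1 = - U 1 3 ∧ U 3 2 = - U 2 3 := by
  refine ⟨?_, ?_, ?_, ?_, hUa _ _, hUa _ _, hUa _ _, hUa _ _, hUa _ _, hUa _ _⟩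
  · linarith [hUa 0 0]
  · linarith [hUa 1 1]
  · linarith [hUa 2 2]
  · linarith [hUa 3 3]

theorem hodge_entries (U : Fin 4 → Fin 4 → ℝ) (hUa : ∀ a b, U a b = - U b a) :
    hodge U 0 0 = 0 ∧ hodge U 1 1 = 0 ∧ hodge U 2 2 = 0 ∧ hodge U 3 3 = 0 ∧
    hodge U 0 1 = - U 2 3 ∧ hodge U 0 2 = U 1 3 ∧ hodge U 0 3 = - U 1 2 ∧
    hodge U 1 0 = U 2 3 ∧ hodge U 2 0 = - U 1 3 ∧ hodge U 3 0 = U 1 2 ∧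
    hodge U 1 2 = U 0 3 ∧ hodge U 1 3 = - U 0 2 ∧ hodge U 2 3 = U 0 1 ∧
    hodge U 2 1 = - U 0 3 ∧ hodge U 3 1 = U 0 2 ∧ hodge U 3 2 = - U 0 1 := by
  obtain ⟨h00, h11, h22, h33, h10, h20, h30, h21, h31, h32⟩ := antisymm_entries U hUa
  refine ⟨?_, ?_, ?_, ?_, ?_, ?_, ?_, ?_, ?_, ?_, ?_, ?_, ?_, ?_, ?_, ?_⟩ <;>
  · simp only [hodge, lev, Fin.sum_univ_four, ηd_zero, ηd_one, ηd_two, ηd_three,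
      h00, h11, h22, h33, h10, h20, h30, h21, h31, h32]
    norm_num
    try ring

/-- Two timelike vectors with negative inner product have the same time orientation. -/
theorem same_orientation (x u : Fin 4 → ℝ) (hx : mink x x < 0) (hu : mink u u < 0)
    (hxu : mink x u < 0) (hu0 : 0 < u 0) : 0 < x 0 := by
  simp only [mink, Fin.sum_univ_four, ηd_zero, ηd_one, ηd_two, ηd_three] at hx hu hxu
  by_contra hn
  push Not at hn
  have hcs : (x 1 * u 1 + x 2 * u 2 + x 3 * u 3) ^ 2 ≤
      (x 1 ^ 2 + x 2 ^ 2 + x 3 ^ 2) * (u 1 ^ 2 + u 2 ^ 2 + u 3 ^ 2) := by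
    nlinarith [sq_nonneg (x 1 * u 2 - x 2 * u 1), sq_nonneg (x 1 * u 3 - x 3 * u 1),
      sq_nonneg (x 2 * u 3 - x 3 * u 2)]
  have h1 : (x 1 ^ 2 + x 2 ^ 2 + x 3 ^ 2) * (u 1 ^ 2 + u 2 ^ 2 + u 3 ^ 2) ≤ x 0 ^ 2 * u 0 ^ 2 := by
    apply mul_le_mul <;> nlinarith [sq_nonneg (u 1), sq_nonneg (u 2), sq_nonneg (u 3)]
  have h2 : 0 ≤ -(x 0) * u 0 := mul_nonneg (by linarith) hu0.le
  nlinarith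

theorem mink_nonneg_of_orth (x u : Fin 4 → ℝ) (hu : mink u u = -1) (h : mink x u = 0) :
    0 ≤ mink x x := by
  simp only [mink, Fin.sum_univ_four, ηd_zero, ηd_one, ηd_two, ηd_three] at hu h ⊢
  have hcs : (x 1 * u 1 + x 2 * u 2 + x 3 * u 3) ^ 2 ≤
      (x 1 ^ 2 + x 2 ^ 2 + x 3 ^ 2) * (u 1 ^ 2 + u 2 ^ 2 + u 3 ^ 2) := by
    nlinarith [sq_nonneg (x 1 * u 2 - x 2 * u 1), sq_nonneg (x 1 * u 3 - x 3 * u 1),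
      sq_nonneg (x 2 * u 3 - x 3 * u 2)]
  have h0 : x 0 * u 0 = x 1 * u 1 + x 2 * u 2 + x 3 * u 3 := by linarith
  have h3 : u 1 ^ 2 + u 2 ^ 2 + u 3 ^ 2 = u 0 ^ 2 - 1 := by linarith
  rw [h3, ← h0] at hcs
  by_contra hn
  push Not at hn
  have hp : 0 < u 0 ^ 2 := by nlinarith [sq_nonneg (u 1), sq_nonneg (u 2), sq_nonneg (u 3)]
  have : (x 1 ^ 2 + x 2 ^ 2 + x 3 ^ 2 - x 0 ^ 2) * u 0 ^ 2 < 0 :=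
    mul_neg_of_neg_of_pos (by linarith) hp
  nlinarith [sq_nonneg (x 1), sq_nonneg (x 2), sq_nonneg (x 3)]

/-- **Projection lemma for a unitary self-dual bivector** (Lemma 4.1).
    Let U be an antisymmetric 2-form with −½U^{ab}U_{ab} = 1 and ⋆U^{ab}U_{ab} = 0,
    and let u be an observer.  With e^a = U^a_b u^b, b^a = ⋆U^a_b u^b and
    P^a_b = U^a_c U^c_b (projector onto the blade Σ of U):
    (i) e·e − b·b = 1, e·b = 0, hence e·e ≥ 1;
    (ii) Pu = (e·e)u + ε^a{}_{bcd}u^d e^b b^c;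
    (iii) η(Pu,Pu) = η(Pu,u) = −e·e < 0, the normalization u_Σ = Pu/√(e·e) is an
    observer in Σ (P u_Σ = u_Σ, future-pointing with u), and
    u_Σ = √(e·e)(u + ν) with ν^a = ε^a{}_{bcd}u^d e^b b^c/(e·e). -/
theorem unitary_selfdual_projection
    (U : Fin 4 → Fin 4 → ℝ) (hUa : ∀ a b, U a b = - U b a)
    (hU1 : -(1/2 : ℝ) * (∑ a, ∑ b, ηd a * ηd b * U a b * U a b) = 1)
    (hU2 : (∑ a, ∑ b, ηd a * ηd b * hodge U a b * U a b) = 0)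
    (u : Fin 4 → ℝ) (hu : IsObserver u) :
    let e : Fin 4 → ℝ := fun a => ηd a * ∑ b, U a b * u b
    let bv : Fin 4 → ℝ := fun a => ηd a * ∑ b, hodge U a b * u b
    let P : Fin 4 → Fin 4 → ℝ := fun a b => ∑ c, (ηd a * U a c) * (ηd c * U c b)
    let Pu : Fin 4 → ℝ := fun a => ∑ b, P a b * u b
    let cross : Fin 4 → ℝ := fun a => ∑ b, ∑ c, ∑ d, ηd a * lev a b c d * u d * e b * bv c
    let uSig : Fin 4 → ℝ := fun a => Pu a / Real.sqrt (mink e e)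
    let ν : Fin 4 → ℝ := fun a => cross a / mink e e
    (mink e e - mink bv bv = 1 ∧ mink e bv = 0 ∧ 1 ≤ mink e e) ∧
    (∀ a, Pu a = mink e e * u a + cross a) ∧
    (mink Pu Pu = -(mink e e) ∧ mink Pu u = -(mink e e) ∧ mink Pu u < 0) ∧
    (mink uSig uSig = -1 ∧ 0 < uSig 0 * u 0 ∧ (∀ a, (∑ b, P a b * uSig b) = uSig a) ∧
      (∀ a, uSig a = Real.sqrt (mink e e) * (u a + ν a))) := by
  intro e bv P Pu cross uSig ν
  obtain ⟨h00, h11, h22, h33, h10, h20, h30, h21, h31, h32⟩ := antisymm_entries U hUa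
  obtain ⟨k00, k11, k22, k33, k01, k02, k03, k10, k20, k30, k12, k13, k23, k21, k31, k32⟩ :=
    hodge_entries U hUa
  obtain ⟨huu, hu0⟩ := hu
  have huu' := huu
  simp only [mink, Fin.sum_univ_four, ηd_zero, ηd_one, ηd_two, ηd_three] at huu'
  simp only [Fin.sum_univ_four, ηd_zero, ηd_one, ηd_two, ηd_three,
    h00, h11, h22, h33, h10, h20, h30, h21, h31, h32,
    k00, k11, k22, k33, k01, k02, k03, k10, k20, k30, k12, k13, k23, k21, k31, k32] at hU1 hU2
  have hQ : U 0 1 ^ 2 + U 0 2 ^ 2 + U 0 3 ^ 2 - U 1 2 ^ 2 - U 1 3 ^ 2 - U 2 3 ^ 2 = 1 := by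
    linarith
  have hF : U 0 1 * U 2 3 - U 0 2 * U 1 3 + U 0 3 * U 1 2 = 0 := by linarith
  have e0 : e 0 = -(U 0 1 * u 1 + U 0 2 * u 2 + U 0 3 * u 3) := by
    simp only [e, Fin.sum_univ_four, ηd_zero, h00]; ring
  have e1 : e 1 = -U 0 1 * u 0 + U 1 2 * u 2 + U 1 3 * u 3 := by
    simp only [e, Fin.sum_univ_four, ηd_one, h11, h10]; ring
  have e2 : e 2 = -U 0 2 * u 0 - U 1 2 * u 1 + U 2 3 * u 3 := by
    simp only [e, Fin.sum_univ_four, ηd_two, h22, h20, h21]; ring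
  have e3 : e 3 = -U 0 3 * u 0 - U 1 3 * u 1 - U 2 3 * u 2 := by
    simp only [e, Fin.sum_univ_four, ηd_three, h33, h30, h31, h32]; ring
  have b0 : bv 0 = U 2 3 * u 1 - U 1 3 * u 2 + U 1 2 * u 3 := by
    simp only [bv, Fin.sum_univ_four, ηd_zero, k00, k01, k02, k03]; ring
  have b1 : bv 1 = U 2 3 * u 0 + U 0 3 * u 2 - U 0 2 * u 3 := by
    simp only [bv, Fin.sum_univ_four, ηd_one, k11, k10, k12, k13]; ring
  have b2 : bv 2 = -U 1 3 * u 0 - U 0 3 * u 1 + U 0 1 * u 3 := by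
    simp only [bv, Fin.sum_univ_four, ηd_two, k22, k20, k21, k23]; ring
  have b3 : bv 3 = U 1 2 * u 0 + U 0 2 * u 1 - U 0 1 * u 2 := by
    simp only [bv, Fin.sum_univ_four, ηd_three, k33, k30, k31, k32]; ring
  clear_value e bv
  have hee : mink e e = -(e 0) ^ 2 + e 1 ^ 2 + e 2 ^ 2 + e 3 ^ 2 := by
    simp only [mink, Fin.sum_univ_four, ηd_zero, ηd_one, ηd_two, ηd_three]; ring
  have hi1 : mink e e - mink bv bv = 1 := by
    simp only [mink, Fin.sum_univ_four, ηd_zero, ηd_one, ηd_two, ηd_three,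
      e0, e1, e2, e3, b0, b1, b2, b3]
    linear_combination (-1 * (-u 0 ^ 2 + u 1 ^ 2 + u 2 ^ 2 + u 3 ^ 2)) * hQ - huu'
  have hi2 : mink e bv = 0 := by
    simp only [mink, Fin.sum_univ_four, ηd_zero, ηd_one, ηd_two, ηd_three,
      e0, e1, e2, e3, b0, b1, b2, b3]
    linear_combination (-u 0 ^ 2 + u 1 ^ 2 + u 2 ^ 2 + u 3 ^ 2) * hF
  have hbu : mink bv u = 0 := by
    simp only [mink, Fin.sum_univ_four, ηd_zero, ηd_one, ηd_two, ηd_three, b0, b1, b2, b3]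
    ring
  have hi3 : 1 ≤ mink e e := by linarith [mink_nonneg_of_orth bv u huu hbu]
  -- `P` is idempotent
  have hPP : ∀ x : Fin 4 → ℝ, ∀ a, (∑ b, P a b * ∑ c, P b c * x c) = ∑ c, P a c * x c := by
    intro x a
    fin_cases a <;>
      simp only [P, Fin.sum_univ_four, Fin.zero_eta, Fin.mk_one, Fin.reduceFinMk,
        ηd_zero, ηd_one, ηd_two, ηd_three, h00, h11, h22, h33, h10, h20, h30, h21, h31, h32]
    · linear_combination (-(U 0 1 * (-U 0 1 * x 0 + U 1 2 * x 2 + U 1 3 * x 3) + U 0 2 * (-U 0 2 * x 0 - U 1 2 * x 1 + U 2 3 * x 3) + U 0 3 * (-U 0 3 * x 0 - U 1 3 * x 1 - U 2 3 * x 2))) * hQ + (U 0 1 * U 2 3 - U 0 2 * U 1 3 + U 0 3 * U 1 2) * x 0 * hF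
    · linear_combination (U 0 1 * (U 0 1 * x 1 + U 0 2 * x 2 + U 0 3 * x 3) + U 1 2 * (-U 0 2 * x 0 - U 1 2 * x 1 + U 2 3 * x 3) + U 1 3 * (-U 0 3 * x 0 - U 1 3 * x 1 - U 2 3 * x 2)) * hQ + (U 0 1 * U 2 3 - U 0 2 * U 1 3 + U 0 3 * U 1 2) * x 1 * hF
    · linear_combination (U 0 2 * (U 0 1 * x 1 + U 0 2 * x 2 + U 0 3 * x 3) - U 1 2 * (-U 0 1 * x 0 + U 1 2 * x 2 + U 1 3 * x 3) + U 2 3 * (-U 0 3 * x 0 - U 1 3 * x 1 - U 2 3 * x 2)) * hQ + (U 0 1 * U 2 3 - U 0 2 * U 1 3 + U 0 3 * U 1 2) * x 2 * hF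
    · linear_combination (U 0 3 * (U 0 1 * x 1 + U 0 2 * x 2 + U 0 3 * x 3) - U 1 3 * (-U 0 1 * x 0 + U 1 2 * x 2 + U 1 3 * x 3) - U 2 3 * (-U 0 2 * x 0 - U 1 2 * x 1 + U 2 3 * x 3)) * hQ + (U 0 1 * U 2 3 - U 0 2 * U 1 3 + U 0 3 * U 1 2) * x 3 * hF
  have Pu0 : Pu 0 = -(U 0 1 * e 1 + U 0 2 * e 2 + U 0 3 * e 3) := by
    simp only [Pu, P, Fin.sum_univ_four, ηd_zero, ηd_one, ηd_two, ηd_three,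
      h00, h11, h22, h33, h10, h20, h30, h21, h31, h32, e1, e2, e3]; ring
  have Pu1 : Pu 1 = -U 0 1 * e 0 + U 1 2 * e 2 + U 1 3 * e 3 := by
    simp only [Pu, P, Fin.sum_univ_four, ηd_zero, ηd_one, ηd_two, ηd_three,
      h00, h11, h22, h33, h10, h20, h30, h21, h31, h32, e0, e2, e3]; ring
  have Pu2 : Pu 2 = -U 0 2 * e 0 - U 1 2 * e 1 + U 2 3 * e 3 := by
    simp only [Pu, P, Fin.sum_univ_four, ηd_zero, ηd_one, ηd_two, ηd_three,
      h00, h11, h22, h33, h10, h20, h30, h21, h31, h32, e0, e1, e3]; ring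
  have Pu3 : Pu 3 = -U 0 3 * e 0 - U 1 3 * e 1 - U 2 3 * e 2 := by
    simp only [Pu, P, Fin.sum_univ_four, ηd_zero, ηd_one, ηd_two, ηd_three,
      h00, h11, h22, h33, h10, h20, h30, h21, h31, h32, e0, e1, e2]; ring
  have hPPu : ∀ a, (∑ b, P a b * Pu b) = Pu a := fun a => hPP u a
  have c0 : cross 0 = e 1 * (bv 2 * u 3 - bv 3 * u 2) - e 2 * (bv 1 * u 3 - bv 3 * u 1)
      + e 3 * (bv 1 * u 2 - bv 2 * u 1) := by
    simp only [cross, lev, Fin.sum_univ_four, ηd_zero]; norm_num; ring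
  have c1 : cross 1 = e 0 * (bv 2 * u 3 - bv 3 * u 2) - e 2 * (bv 0 * u 3 - bv 3 * u 0)
      + e 3 * (bv 0 * u 2 - bv 2 * u 0) := by
    simp only [cross, lev, Fin.sum_univ_four, ηd_one]; norm_num; ring
  have c2 : cross 2 = -e 0 * (bv 1 * u 3 - bv 3 * u 1) + e 1 * (bv 0 * u 3 - bv 3 * u 0)
      - e 3 * (bv 0 * u 1 - bv 1 * u 0) := by
    simp only [cross, lev, Fin.sum_univ_four, ηd_two]; norm_num; ring
  have c3 : cross 3 = e 0 * (bv 1 * u 2 - bv 2 * u 1) - e 1 * (bv 0 * u 2 - bv 2 * u 0)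
      + e 2 * (bv 0 * u 1 - bv 1 * u 0) := by
    simp only [cross, lev, Fin.sum_univ_four, ηd_three]; norm_num; ring
  have hii : ∀ a, Pu a = mink e e * u a + cross a := by
    intro a
    rw [hee]
    fin_cases a <;> simp only [Fin.zero_eta, Fin.mk_one, Fin.reduceFinMk]
    · rw [Pu0, c0, e0, e1, e2, e3, b1, b2, b3]
      linear_combination (-(U 0 1 * (-U 0 1 * u 0 + U 1 2 * u 2 + U 1 3 * u 3) + U 0 2 * (-U 0 2 * u 0 - U 1 2 * u 1 + U 2 3 * u 3) + U 0 3 * (-U 0 3 * u 0 - U 1 3 * u 1 - U 2 3 * u 2))) * huu'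
    · rw [Pu1, c1, e0, e1, e2, e3, b0, b2, b3]
      linear_combination (U 0 1 * (U 0 1 * u 1 + U 0 2 * u 2 + U 0 3 * u 3) + U 1 2 * (-U 0 2 * u 0 - U 1 2 * u 1 + U 2 3 * u 3) + U 1 3 * (-U 0 3 * u 0 - U 1 3 * u 1 - U 2 3 * u 2)) * huu'
    · rw [Pu2, c2, e0, e1, e2, e3, b0, b1, b3]
      linear_combination (U 0 2 * (U 0 1 * u 1 + U 0 2 * u 2 + U 0 3 * u 3) - U 1 2 * (-U 0 1 * u 0 + U 1 2 * u 2 + U 1 3 * u 3) + U 2 3 * (-U 0 3 * u 0 - U 1 3 * u 1 - U 2 3 * u 2)) * huu'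
    · rw [Pu3, c3, e0, e1, e2, e3, b0, b1, b2]
      linear_combination (U 0 3 * (U 0 1 * u 1 + U 0 2 * u 2 + U 0 3 * u 3) - U 1 3 * (-U 0 1 * u 0 + U 1 2 * u 2 + U 1 3 * u 3) - U 2 3 * (-U 0 2 * u 0 - U 1 2 * u 1 + U 2 3 * u 3)) * huu'
  have hPuu : mink Pu u = -(mink e e) := by
    rw [hee]
    simp only [mink, Fin.sum_univ_four, ηd_zero, ηd_one, ηd_two, ηd_three,
      Pu0, Pu1, Pu2, Pu3, e0, e1, e2, e3]
    ring
  have hPuPu : mink Pu Pu = -(mink e e) := by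
    -- `P` is symmetric and idempotent
    rw [← hPuu]
    have hs : mink Pu Pu = mink (fun a => ∑ b, P a b * Pu b) u := by
      generalize hy : Pu = y
      simp only [← hy, mink, Pu, P, Fin.sum_univ_four, ηd_zero, ηd_one, ηd_two, ηd_three,
        h00, h11, h22, h33, h10, h20, h30, h21, h31, h32]
      ring
    rw [hs]
    congr 1
    exact funext hPPu
  have hpos : 0 < mink e e := by linarith
  have hsq : Real.sqrt (mink e e) * Real.sqrt (mink e e) = mink e e := Real.mul_self_sqrt hpos.le
  have hs : 0 < Real.sqrt (mink e e) := Real.sqrt_pos.mpr hpos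
  refine ⟨⟨hi1, hi2, hi3⟩, hii, ⟨hPuPu, hPuu, by linarith⟩, ?_, ?_, ?_, ?_⟩
  · have : mink uSig uSig = mink Pu Pu / (Real.sqrt (mink e e) * Real.sqrt (mink e e)) := by
      simp only [uSig, mink, Finset.sum_div]
      refine Finset.sum_congr rfl fun a _ => ?_
      field_simp
    rw [this, hsq, hPuPu]
    field_simp
  · have : 0 < Pu 0 := same_orientation Pu u (by linarith) (by linarith) (by linarith) hu0
    exact mul_pos (div_pos this hs) hu0
  · intro a
    simp only [uSig]
    rw [← hPPu a, Finset.sum_div]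
    refine Finset.sum_congr rfl fun b _ => ?_
    ring
  · intro a
    simp only [uSig, ν]
    rw [hii a, div_eq_iff hs.ne']
    have : Real.sqrt (mink e e) * (u a + cross a / mink e e) * Real.sqrt (mink e e)
        = (Real.sqrt (mink e e) * Real.sqrt (mink e e)) * (u a + cross a / mink e e) := by ring
    rw [this, hsq]
    field_simp
end
end

section
/- Velocity of the principal observer for Petrov type I (Proposition 5.3). With the definitions in the context: (i) 2(u⁰)² = ½·Σ_{i=1}^{3} η(x_i, conj(x_i)) + ½ = Σ_{i=1}^{3} η(e_i, e_i) − 1; (ii) the velocity ν := δ₀/u⁰ − u of the principal observer δ₀ relative to u satisfies ν = −(1/(2(u⁰)²))·Σ_{(ijk) cyclic} Im(η(x_j, conj(x_k)))·x_i (the right-hand side being a real vector), equivalently ν = (1/(u⁰)²)·Σ_{(ijk) cyclic} η(b_j, e_k)·e_i. Hence the principal observer is δ₀ = u⁰·(u + ν). -/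
open scoped BigOperators

noncomputable section

/-- Minkowski inner product on ℝ⁴. -/
def minkR (x y : Fin 4 → ℝ) : ℝ := -(x 0 * y 0) + x 1 * y 1 + x 2 * y 2 + x 3 * y 3

/-- The Minkowski inner product extended bilinearly to ℂ⁴. -/
def minkC (x y : Fin 4 → ℂ) : ℂ := -(x 0 * y 0) + x 1 * y 1 + x 2 * y 2 + x 3 * y 3

/-- Componentwise complex conjugation on ℂ⁴. -/
def cj (x : Fin 4 → ℂ) : Fin 4 → ℂ := fun a => starRingEnd ℂ (x a)

/-- **Velocity of the principal observer for Petrov type I** (Proposition 5.3).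
    Let u = (u⁰,u¹,u²,u³) with u⁰ = √(1+Σ(uⁱ)²) be an arbitrary observer expanded in the
    Weyl principal tetrad (identified with the standard basis), and let
    x_i = uⁱδ₀ + u⁰δ_i + i(u^kδ_j − u^jδ_k) = e_i − i b_i be the unit eigenvectors of
    Q = E − iH relative to u.  Then:
    (i) 2(u⁰)² = ½Σᵢ η(xᵢ, conj(xᵢ)) + ½ = Σᵢ η(eᵢ,eᵢ) − 1;
    (ii) the relative velocity ν = δ₀/u⁰ − u of the principal observer δ₀ satisfies
    ν = −(1/(2(u⁰)²)) Σ_{(ijk)} Im(η(x_j, conj(x_k)))·x_i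
      = (1/(u⁰)²) Σ_{(ijk)} η(b_j,e_k)·e_i ;
    hence the principal observer is δ₀ = u⁰(u + ν). -/
theorem typeI_principal_observer_velocity (u1 u2 u3 : ℝ) :
    let u0 : ℝ := Real.sqrt (1 + u1^2 + u2^2 + u3^2)
    let u : Fin 4 → ℝ := ![u0, u1, u2, u3]
    let x1 : Fin 4 → ℂ := ![(u1 : ℂ), (u0 : ℂ), Complex.I * (u3 : ℂ), -(Complex.I * (u2 : ℂ))]
    let x2 : Fin 4 → ℂ := ![(u2 : ℂ), -(Complex.I * (u3 : ℂ)), (u0 : ℂ), Complex.I * (u1 : ℂ)]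
    let x3 : Fin 4 → ℂ := ![(u3 : ℂ), Complex.I * (u2 : ℂ), -(Complex.I * (u1 : ℂ)), (u0 : ℂ)]
    let e1 : Fin 4 → ℝ := ![u1, u0, 0, 0]
    let e2 : Fin 4 → ℝ := ![u2, 0, u0, 0]
    let e3 : Fin 4 → ℝ := ![u3, 0, 0, u0]
    let b1 : Fin 4 → ℝ := ![0, 0, -u3, u2]
    let b2 : Fin 4 → ℝ := ![0, u3, 0, -u1]
    let b3 : Fin 4 → ℝ := ![0, -u2, u1, 0]
    let δ0 : Fin 4 → ℝ := ![1, 0, 0, 0]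
    let ν : Fin 4 → ℝ := fun a => δ0 a / u0 - u a
    (∀ a, x1 a = (e1 a : ℂ) - Complex.I * (b1 a : ℂ)) ∧
    (∀ a, x2 a = (e2 a : ℂ) - Complex.I * (b2 a : ℂ)) ∧
    (∀ a, x3 a = (e3 a : ℂ) - Complex.I * (b3 a : ℂ)) ∧
    ((2 * (u0 : ℂ)^2 = (1/2) * (minkC x1 (cj x1) + minkC x2 (cj x2) + minkC x3 (cj x3)) + 1/2)
      ∧ (2 * u0^2 = (minkR e1 e1 + minkR e2 e2 + minkR e3 e3) - 1)) ∧
    (∀ a, (ν a : ℂ) = -(1/(2 * (u0 : ℂ)^2)) *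
        (((minkC x2 (cj x3)).im : ℂ) * x1 a + ((minkC x3 (cj x1)).im : ℂ) * x2 a +
         ((minkC x1 (cj x2)).im : ℂ) * x3 a)) ∧
    (∀ a, ν a = (1/u0^2) *
        (minkR b2 e3 * e1 a + minkR b3 e1 * e2 a + minkR b1 e2 * e3 a)) ∧
    (∀ a, δ0 a = u0 * (u a + ν a)) := by
  intro u0 u x1 x2 x3 e1 e2 e3 b1 b2 b3 δ0 ν
  have hpos : 0 < u0 := Real.sqrt_pos.mpr (by positivity)
  have hsq : u0 ^ 2 = 1 + u1 ^ 2 + u2 ^ 2 + u3 ^ 2 := Real.sq_sqrt (by positivity)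
  have hne : u0 ≠ 0 := hpos.ne'
  clear_value u0
  have hneC : (u0 : ℂ) ≠ 0 := by exact_mod_cast hne
  have hsqC : (u0 : ℂ) ^ 2 = 1 + (u1 : ℂ) ^ 2 + (u2 : ℂ) ^ 2 + (u3 : ℂ) ^ 2 := by
    exact_mod_cast hsq
  have hI : Complex.I ^ 2 = -1 := Complex.I_sq
  have h23 : (minkC x2 (cj x3)).im = 2 * u0 * u1 := by
    simp [minkC, cj, x2, x3]; ring
  have h31 : (minkC x3 (cj x1)).im = 2 * u0 * u2 := by
    simp [minkC, cj, x3, x1]; ring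
  have h12 : (minkC x1 (cj x2)).im = 2 * u0 * u3 := by
    simp [minkC, cj, x1, x2]; ring
  have g23 : minkR b2 e3 = -(u0 * u1) := by
    simp [minkR, b2, e3]; ring
  have g31 : minkR b3 e1 = -(u0 * u2) := by
    simp [minkR, b3, e1]; ring
  have g12 : minkR b1 e2 = -(u0 * u3) := by
    simp [minkR, b1, e2]; ring
  refine ⟨?_, ?_, ?_, ⟨?_, ?_⟩, ?_, ?_, ?_⟩
  · intro a; fin_cases a <;> simp [x1, e1, b1]
  · intro a; fin_cases a <;> simp [x2, e2, b2]
  · intro a; fin_cases a <;> simp [x3, e3, b3]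
  · simp [minkC, cj, x1, x2, x3]
    linear_combination (1 / 2 : ℂ) * hsqC +
      ((u1 : ℂ) ^ 2 + (u2 : ℂ) ^ 2 + (u3 : ℂ) ^ 2) * hI
  · simp [minkR, e1, e2, e3]
    linear_combination -hsq
  · intro a
    rw [h23, h31, h12]
    fin_cases a <;> simp [ν, δ0, u, x1, x2, x3] <;> field_simp
    · linear_combination -hsqC
    all_goals ring
  · intro a
    rw [g23, g31, g12]
    fin_cases a <;> simp [ν, δ0, u, e1, e2, e3] <;> field_simp
    linear_combination -hsq
  · intro a
    simp only [ν]
    field_simp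
    ring
end
end

section
/- Normal form of a Petrov type D complex Weyl matrix. Let Q be a complex symmetric 3×3 matrix with tr Q = 0, and let λ ∈ ℂ with λ ≠ 0 be such that (Q − λ·1₃)(Q + 2λ·1₃) = 0 (the Petrov type D condition). Then there exists v ∈ ℂ³ with vᵀv := Σ_a v_a² = 1 such that Q = λ(1₃ − 3 v vᵀ). -/
open scoped BigOperators

noncomputable section

/-- A symmetric idempotent 3×3 matrix of trace one has vanishing 2×2 minors. -/
lemma minors_aux (P : Fin 3 → Fin 3 → ℂ) (hs : ∀ i j, P i j = P j i)
    (ht : P 0 0 + P 1 1 + P 2 2 = 1)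
    (hP : ∀ i j, P i 0 * P 0 j + P i 1 * P 1 j + P i 2 * P 2 j = P i j) :
    ∀ i j k, P i i * P j k = P i j * P i k := by
  have h10 := hs 1 0
  have h20 := hs 2 0
  have h21 := hs 2 1
  have e00 := hP 0 0
  have e01 := hP 0 1
  have e02 := hP 0 2
  have e11 := hP 1 1
  have e12 := hP 1 2
  have e22 := hP 2 2
  clear hP hs
  simp only [h10, h20, h21] at e00 e01 e02 e11 e12 e22
  have hc : P 2 2 = 1 - P 0 0 - P 1 1 := by linear_combination ht
  intro i j k
  fin_cases i <;> fin_cases j <;> fin_cases k <;>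
    simp only [Fin.zero_eta, Fin.mk_one, Fin.reduceFinMk, h10, h20, h21] <;> grind

/-- **Normal form of a Petrov type D complex Weyl matrix.**  If Q is a complex symmetric
    trace-free 3×3 matrix and λ ≠ 0 satisfies the Petrov type D condition
    (Q − λ·1)(Q + 2λ·1) = 0, then Q = λ(1 − 3vvᵀ) for some v ∈ ℂ³ with vᵀv = 1. -/
theorem typeD_normal_form
    (Q : Matrix (Fin 3) (Fin 3) ℂ) (hsym : Q.transpose = Q)
    (htr : Matrix.trace Q = 0)
    (lam : ℂ) (hlam : lam ≠ 0)
    (hD : (Q - lam • (1 : Matrix (Fin 3) (Fin 3) ℂ)) *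
          (Q + (2 * lam) • (1 : Matrix (Fin 3) (Fin 3) ℂ)) = 0) :
    ∃ v : Fin 3 → ℂ, (∑ a, v a ^ 2) = 1 ∧
      Q = lam • ((1 : Matrix (Fin 3) (Fin 3) ℂ) - (3 : ℂ) • Matrix.vecMulVec v v) := by
  have hs : ∀ i j, Q i j = Q j i := fun i j => by
    conv_lhs => rw [← hsym]
    rfl
  have htr' : Q 0 0 + Q 1 1 + Q 2 2 = 0 := by
    simpa [Matrix.trace, Fin.sum_univ_three] using htr
  have hQQ : Q * Q = (2 * lam ^ 2) • (1 : Matrix (Fin 3) (Fin 3) ℂ) - lam • Q := by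
    have h : (Q - lam • (1 : Matrix (Fin 3) (Fin 3) ℂ)) *
          (Q + (2 * lam) • (1 : Matrix (Fin 3) (Fin 3) ℂ))
        = Q * Q - ((2 * lam ^ 2) • (1 : Matrix (Fin 3) (Fin 3) ℂ) - lam • Q) := by
      simp only [sub_mul, mul_add, Matrix.smul_mul, Matrix.mul_smul, one_mul, mul_one]
      module
    rw [h] at hD
    exact sub_eq_zero.mp hD
  have hlQ : ∃ P : Matrix (Fin 3) (Fin 3) ℂ,
      Q = lam • ((1 : Matrix (Fin 3) (Fin 3) ℂ) - (3 : ℂ) • P) := by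
    refine ⟨(3 : ℂ)⁻¹ • (1 - lam⁻¹ • Q), ?_⟩
    rw [smul_smul, mul_inv_cancel₀ (by norm_num), one_smul, sub_sub_cancel, smul_smul,
      mul_inv_cancel₀ hlam, one_smul]
  obtain ⟨P, hQ⟩ := hlQ
  have hent : ∀ i j, Q i j = lam * ((1 : Matrix (Fin 3) (Fin 3) ℂ) i j - 3 * P i j) := by
    intro i j
    rw [hQ]
    simp
  have hPs : ∀ i j, P i j = P j i := by
    intro i j
    have h := hs i j
    rw [hent, hent] at h
    have h2 := mul_left_cancel₀ hlam h
    have h3 : (1 : Matrix (Fin 3) (Fin 3) ℂ) i j = (1 : Matrix (Fin 3) (Fin 3) ℂ) j i := by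
      simp [Matrix.one_apply, eq_comm]
    linear_combination (h3 - h2) / 3
  have hPt : P 0 0 + P 1 1 + P 2 2 = 1 := by
    rw [hent, hent, hent] at htr'
    simp only [Matrix.one_apply_eq] at htr'
    apply mul_left_cancel₀ hlam
    linear_combination -htr' / 3
  have hPP : P * P = P := by
    have h : (9 * lam ^ 2) • (P * P - P) = 0 := by
      have h2 := sub_eq_zero.mpr hQQ
      rw [← h2, hQ]
      simp only [sub_mul, mul_sub, Matrix.smul_mul, Matrix.mul_smul, one_mul, mul_one]
      module
    exact sub_eq_zero.mp ((smul_eq_zero.mp h).resolve_left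
      (mul_ne_zero (by norm_num) (pow_ne_zero 2 hlam)))
  have hm := minors_aux P hPs hPt (fun i j => by
    conv_rhs => rw [← hPP]
    simp [Matrix.mul_apply, Fin.sum_univ_three])
  have hi : ∃ i, P i i ≠ 0 := by
    by_contra! h
    rw [h, h, h] at hPt
    norm_num at hPt
  obtain ⟨i, hi⟩ := hi
  obtain ⟨s, hss⟩ := (IsAlgClosed.exists_eq_mul_self (P i i))
  have hs0 : s ≠ 0 := by
    rintro rfl
    simp at hss
    exact hi hss
  have hv : ∀ j k, P i j / s * (P i k / s) = P j k := by
    intro j k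
    rw [div_mul_div_comm, ← hss, ← hm, mul_div_cancel_left₀ _ hi]
  refine ⟨fun j => P i j / s, ?_, ?_⟩
  · simp only [Fin.sum_univ_three, pow_two, hv]
    exact hPt
  · have : Matrix.vecMulVec (fun j => P i j / s) (fun j => P i j / s) = P := by
      ext j k
      rw [Matrix.vecMulVec_apply, hv]
    rw [this]
    exact hQ
end
end

section
/- Super-Poynting vector in Petrov type D (Eq. (5.29)). Let λ ∈ ℂ, v ∈ ℂ³ with vᵀv = 1, Q := λ(1₃ − 3 v vᵀ), and write v = e − i b with e, b ∈ ℝ³. Then: (i) the matrix commutator satisfies Q·conj(Q) − conj(Q)·Q = 9|λ|²·σ·(v·conj(v)ᵀ − conj(v)·vᵀ), where σ := Σ_a v_a conj(v_a) = e·e + b·b; (ii) the super-Poynting vector, defined componentwise by 𝒫_a := (1/(4i))·Σ_{b,c,d} ε_{abc} Q_{bd} conj(Q)_{dc} (ε the alternating symbol on three indices with ε₁₂₃ = 1), equals 𝒫 = (9|λ|²/2)·σ·(e × b). In particular, 𝒫 is a real vector parallel to the cross product of e and b. -/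
open scoped BigOperators

noncomputable section

/-- Alternating symbol on three indices with ε₁₂₃ = 1. -/
def eps3 (a b c : Fin 3) : ℝ :=
  (((b.val : ℝ) - a.val) * ((c.val : ℝ) - a.val) * ((c.val : ℝ) - b.val)) / 2

/-- Cross product on ℝ³. -/
def cross3 (x y : Fin 3 → ℝ) (a : Fin 3) : ℝ := ∑ b, ∑ c, eps3 a b c * x b * y c

/-- Entrywise complex conjugate of a matrix. -/
def mconj (M : Matrix (Fin 3) (Fin 3) ℂ) : Matrix (Fin 3) (Fin 3) ℂ :=
  M.map (starRingEnd ℂ)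

/-- The Petrov type D complex Weyl tensor Q = λ(1₃ − 3vvᵀ) relative to an observer. -/
def QD (lam : ℂ) (v : Fin 3 → ℂ) : Matrix (Fin 3) (Fin 3) ℂ :=
  lam • ((1 : Matrix (Fin 3) (Fin 3) ℂ) - (3 : ℂ) • Matrix.vecMulVec v v)

/-- **Super-Poynting vector in Petrov type D** (Eq. (5.29)).  With Q = λ(1−3vvᵀ),
    vᵀv = 1 and v = e − ib:  (i) σ = Σv_a conj(v_a) = e·e + b·b and the commutator
    Q·conj(Q) − conj(Q)·Q equals 9|λ|²σ(v·conj(v)ᵀ − conj(v)·vᵀ);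
    (ii) the super-Poynting vector 𝒫_a = (1/(4i))Σε_{abc}Q_{bd}conj(Q)_{dc} equals
    (9|λ|²/2)σ(e×b): a real vector parallel to the cross product of e and b. -/
theorem typeD_superPoynting
    (lam : ℂ) (v : Fin 3 → ℂ) (e bb : Fin 3 → ℝ)
    (hv : ∀ a, v a = (e a : ℂ) - Complex.I * (bb a : ℂ))
    (hunit : (∑ a, v a ^ 2) = 1) :
    let σ : ℝ := ∑ a, Complex.normSq (v a)
    let Q : Matrix (Fin 3) (Fin 3) ℂ := QD lam v
    let vbar : Fin 3 → ℂ := fun a => starRingEnd ℂ (v a)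
    (σ = (∑ a, e a * e a) + (∑ a, bb a * bb a)) ∧
    (Q * mconj Q - mconj Q * Q
      = ((9 * Complex.normSq lam * σ : ℝ) : ℂ) •
          (Matrix.vecMulVec v vbar - Matrix.vecMulVec vbar v)) ∧
    (∀ a, (1/(4*Complex.I)) *
        (∑ b, ∑ c, ∑ d, ((eps3 a b c : ℝ) : ℂ) * Q b d * starRingEnd ℂ (Q d c))
      = (((9 * Complex.normSq lam / 2) * σ * cross3 e bb a : ℝ) : ℂ)) := by
  intro σ Q vbar
  have hn : ∀ a, Complex.normSq (v a) = e a * e a + bb a * bb a := by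
    intro a
    rw [hv a, Complex.normSq_apply]
    simp
  have hc : ∀ a, starRingEnd ℂ (v a) = (e a : ℂ) + Complex.I * (bb a : ℂ) := by
    intro a
    rw [hv a]
    simp
  have hσ : σ = (∑ a, e a * e a) + (∑ a, bb a * bb a) := by
    simp only [σ, hn, Finset.sum_add_distrib]
  have hσc : (σ : ℂ) = ∑ a, v a * vbar a := by
    simp only [σ, vbar, Complex.mul_conj, Complex.ofReal_sum]
  have hl : (Complex.normSq lam : ℂ) = lam * starRingEnd ℂ lam := (Complex.mul_conj lam).symm
  have hQ : ∀ i j, Q i j = lam * ((if i = j then 1 else 0) - 3 * (v i * v j)) := by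
    intro i j
    simp [Q, QD, Matrix.vecMulVec_apply, Matrix.one_apply]
  have hQc : ∀ i j, starRingEnd ℂ (Q i j)
      = starRingEnd ℂ lam * ((if i = j then 1 else 0) - 3 * (vbar i * vbar j)) := by
    intro i j
    have h3 : starRingEnd ℂ (3 : ℂ) = 3 := Complex.conj_ofNat 3
    rw [hQ]
    split_ifs <;> simp [vbar, h3]
  refine ⟨hσ, ?_, ?_⟩
  · ext i j
    simp only [Matrix.sub_apply, Matrix.mul_apply, Matrix.smul_apply, mconj, Matrix.map_apply,
      hQc, Matrix.vecMulVec_apply, smul_eq_mul, Complex.ofReal_mul, hl, hσc]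
    simp only [hQ]
    clear_value vbar
    fin_cases i <;> fin_cases j <;> simp [Fin.sum_univ_three] <;> ring
  · intro a
    have key : (∑ b, ∑ c, ∑ d, ((eps3 a b c : ℝ) : ℂ) * Q b d * starRingEnd ℂ (Q d c))
        = 4 * Complex.I * (((9 * Complex.normSq lam / 2) * σ * cross3 e bb a : ℝ) : ℂ) := by
      have hvb : ∀ a, vbar a = (e a : ℂ) + Complex.I * (bb a : ℂ) := hc
      have hcr : 2 * Complex.I * ((cross3 e bb a : ℝ) : ℂ)
          = ∑ b, ∑ c, ((eps3 a b c : ℝ) : ℂ) * v b * vbar c := by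
        simp only [cross3, hv, hvb, eps3]
        fin_cases a <;> simp [Fin.sum_univ_three] <;> ring
      have : 4 * Complex.I * (((9 * Complex.normSq lam / 2) * σ * cross3 e bb a : ℝ) : ℂ)
          = 9 * (Complex.normSq lam : ℂ) * σ * (2 * Complex.I * ((cross3 e bb a : ℝ) : ℂ)) := by
        push_cast
        ring
      rw [this, hcr, hl, hσc]
      simp only [hQc, eps3]
      simp only [hQ]
      clear_value vbar
      fin_cases a <;> simp [Fin.sum_univ_three] <;> ring
    rw [key]
    have hI := Complex.I_ne_zero
    field_simp
end
end

section
/- Super-energy density in Petrov type D and its minimality (Eq. (5.31) and characterization (iv)). Let λ ∈ ℂ, v ∈ ℂ³ with vᵀv = 1, Q := λ(1₃ − 3 v vᵀ), and write v = e − i b with e, b ∈ ℝ³, σ := Σ_a v_a conj(v_a) = e·e + b·b. Then tr(Q·conj(Q)) = 3|λ|²(3σ² − 1). Moreover σ ≥ 1 (since e·e − b·b = 1), so the super-energy density W := ¼ tr(Q·conj(Q)) satisfies W ≥ (3/2)|λ|² = ¼|I| (where I := tr(Q²) = 6λ²), with equality if and only if b = 0 (i.e., v is real, i.e., the observer is principal).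 -/
open scoped BigOperators

noncomputable section

/-- **Super-energy density in Petrov type D and its minimality** (Eq. (5.31) and
    characterization (iv)).  With Q = λ(1−3vvᵀ), λ ≠ 0 (type D), vᵀv = 1 and v = e − ib:
    tr(Q·conj(Q)) = 3|λ|²(3σ²−1), I = tr(Q²) = 6λ², e·e − b·b = 1 so σ ≥ 1, and the
    super-energy density W = ¼tr(Q·conj(Q)) satisfies W ≥ (3/2)|λ|² = ¼|I|, with equality
    iff b = 0 (v real, the observer principal). -/
theorem typeD_superenergy_minimality
    (lam : ℂ) (hlam : lam ≠ 0) (v : Fin 3 → ℂ) (e bb : Fin 3 → ℝ)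
    (hv : ∀ a, v a = (e a : ℂ) - Complex.I * (bb a : ℂ))
    (hunit : (∑ a, v a ^ 2) = 1) :
    let σ : ℝ := ∑ a, Complex.normSq (v a)
    let Q : Matrix (Fin 3) (Fin 3) ℂ := QD lam v
    let W : ℝ := (1/4) * (Matrix.trace (Q * mconj Q)).re
    (Matrix.trace (Q * mconj Q) = (((3 * Complex.normSq lam * (3*σ^2 - 1)) : ℝ) : ℂ)) ∧
    (Matrix.trace (Q * Q) = 6 * lam^2) ∧
    ((∑ a, e a * e a) - (∑ a, bb a * bb a) = 1) ∧
    (1 ≤ σ) ∧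
    ((3/2) * Complex.normSq lam ≤ W) ∧
    (W = (3/2) * Complex.normSq lam ↔ bb = 0) := by
  intro σ Q W
  have hre : (∑ a, e a * e a) - (∑ a, bb a * bb a) = 1 := by
    have h := congrArg Complex.re hunit
    simp only [Fin.sum_univ_three, hv] at h ⊢
    simp [pow_two] at h
    linarith
  have hσ : σ = (∑ a, e a * e a) + (∑ a, bb a * bb a) := by
    simp only [σ, Fin.sum_univ_three, hv, Complex.normSq_apply]
    simp
    ring
  have hb : 0 ≤ ∑ a, bb a * bb a := Finset.sum_nonneg fun a _ => mul_self_nonneg _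
  have hσ1 : 1 ≤ σ := by linarith
  have hL : 0 < Complex.normSq lam := Complex.normSq_pos.mpr hlam
  have hT : Matrix.trace (Q * mconj Q)
      = (((3 * Complex.normSq lam * (3*σ^2 - 1)) : ℝ) : ℂ) := by
    have h' := congrArg (starRingEnd ℂ) hunit
    have h := hunit
    simp only [σ, Q, QD, mconj, Matrix.trace, Matrix.diag, Matrix.mul_apply,
      Fin.sum_univ_three, Matrix.map_apply, Matrix.smul_apply, Matrix.sub_apply,
      Matrix.vecMulVec_apply, Matrix.one_apply, smul_eq_mul, map_mul, map_sub, map_add,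
      map_pow, map_one, Complex.ofReal_mul, Complex.ofReal_sub, Complex.ofReal_add,
      Complex.ofReal_pow, ← Complex.mul_conj] at h h' ⊢
    have h3 : (starRingEnd ℂ) 3 = 3 := Complex.conj_ofNat 3
    simp [-Complex.mul_conj, h3]
    linear_combination (-3 * lam * (starRingEnd ℂ) lam) * (h + h')
  have hI : Matrix.trace (Q * Q) = 6 * lam^2 := by
    have h := hunit
    simp only [Q, QD, Matrix.trace, Matrix.diag, Matrix.mul_apply,
      Fin.sum_univ_three, Matrix.smul_apply, Matrix.sub_apply,
      Matrix.vecMulVec_apply, Matrix.one_apply, smul_eq_mul] at h ⊢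
    simp
    linear_combination lam^2 * (9 * (v 0 ^ 2 + v 1 ^ 2 + v 2 ^ 2) + 3) * h
  have hW : W = (1/4) * (3 * Complex.normSq lam * (3*σ^2 - 1)) := by
    simp only [W]
    rw [hT, Complex.ofReal_re]
  have hd : W - (3/2) * Complex.normSq lam
      = (9/4) * Complex.normSq lam * ((σ + 1) * (σ - 1)) := by
    rw [hW]; ring
  refine ⟨hT, hI, hre, hσ1, ?_, ?_⟩
  · have : 0 ≤ (9/4) * Complex.normSq lam * ((σ + 1) * (σ - 1)) :=
      mul_nonneg (by positivity) (mul_nonneg (by linarith) (by linarith))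
    linarith
  · constructor
    · intro h
      rw [h, sub_self] at hd
      have h1 : σ - 1 = 0 := by
        rcases mul_eq_zero.mp hd.symm with h2 | h2
        · linarith
        · rcases mul_eq_zero.mp h2 with h3 | h3
          · linarith
          · exact h3
      have h0 : ∑ a, bb a * bb a = 0 := by linarith
      rw [Finset.sum_eq_zero_iff_of_nonneg (fun a _ => mul_self_nonneg _)] at h0
      funext a
      exact mul_self_eq_zero.mp (h0 a (Finset.mem_univ a))
    · intro h
      have h0 : ∑ a, bb a * bb a = 0 := by simp [h]
      have h1 : σ - 1 = 0 := by linarith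
      rw [h1] at hd
      linarith
end
end

section
/- The super-Poynting direction is the unique real eigendirection in Petrov type D (Remark 5.2). Let λ ∈ ℂ, λ ≠ 0, v ∈ ℂ³ with vᵀv = 1, Q := λ(1₃ − 3 v vᵀ), and write v = e − i b with e, b ∈ ℝ³. Then: (i) Q(e × b) = λ(e × b); (ii) if b ≠ 0 (the observer is non-principal), then e × b ≠ 0 and every nonzero real vector w ∈ ℝ³ satisfying Qw = μw for some μ ∈ ℂ is a real scalar multiple of e × b (necessarily with μ = λ). Hence for a non-principal observer the super-Poynting vector spans the unique real eigendirection of Q = E − iH, which is the unique common eigendirection of E and H. -/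
open scoped BigOperators

noncomputable section

theorem cross3_zero (x y : Fin 3 → ℝ) : cross3 x y 0 = x 1 * y 2 - x 2 * y 1 := by
  simp [cross3, eps3, Fin.sum_univ_three]; ring

theorem cross3_one (x y : Fin 3 → ℝ) : cross3 x y 1 = x 2 * y 0 - x 0 * y 2 := by
  simp [cross3, eps3, Fin.sum_univ_three]; ring

theorem cross3_two (x y : Fin 3 → ℝ) : cross3 x y 2 = x 0 * y 1 - x 1 * y 0 := by
  simp [cross3, eps3, Fin.sum_univ_three]; ring

theorem QD_apply_sum (lam : ℂ) (v u : Fin 3 → ℂ) (a : Fin 3) :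
    (∑ c, QD lam v a c * u c) = lam * (u a - 3 * v a * (∑ c, v c * u c)) := by
  fin_cases a <;>
    simp [QD, Fin.sum_univ_three, Matrix.vecMulVec_apply, Matrix.one_apply] <;> ring

theorem sq_pos_of_ne (x : Fin 3 → ℝ) (hx : x ≠ 0) : 0 < x 0 ^ 2 + x 1 ^ 2 + x 2 ^ 2 := by
  by_contra h
  apply hx
  have h0 : x 0 = 0 := by nlinarith [sq_nonneg (x 0), sq_nonneg (x 1), sq_nonneg (x 2)]
  have h1 : x 1 = 0 := by nlinarith [sq_nonneg (x 0), sq_nonneg (x 1), sq_nonneg (x 2)]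
  have h2 : x 2 = 0 := by nlinarith [sq_nonneg (x 0), sq_nonneg (x 1), sq_nonneg (x 2)]
  funext a
  fin_cases a <;> simp [h0, h1, h2]

/-- **The super-Poynting direction is the unique real eigendirection in Petrov type D**
    (Remark 5.2).  With Q = λ(1−3vvᵀ), λ ≠ 0, vᵀv = 1, v = e − ib:
    (i) Q(e×b) = λ(e×b);
    (ii) if b ≠ 0 (non-principal observer) then e×b ≠ 0 and every nonzero real
    eigenvector w of Q (Qw = μw) has μ = λ and is a real scalar multiple of e×b.
    Hence the super-Poynting vector spans the unique real eigendirection of Q = E − iH,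
    the unique common eigendirection of E and H. -/
theorem typeD_unique_real_eigendirection
    (lam : ℂ) (hlam : lam ≠ 0) (v : Fin 3 → ℂ) (e bb : Fin 3 → ℝ)
    (hv : ∀ a, v a = (e a : ℂ) - Complex.I * (bb a : ℂ))
    (hunit : (∑ a, v a ^ 2) = 1) :
    (∀ a, (∑ c, QD lam v a c * ((cross3 e bb c : ℝ) : ℂ)) = lam * ((cross3 e bb a : ℝ) : ℂ)) ∧
    (bb ≠ 0 →
      (cross3 e bb ≠ 0 ∧
       ∀ (w : Fin 3 → ℝ) (μ : ℂ), w ≠ 0 →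
         (∀ a, (∑ c, QD lam v a c * ((w c : ℝ) : ℂ)) = μ * ((w a : ℝ) : ℂ)) →
         (μ = lam ∧ ∃ t : ℝ, ∀ a, w a = t * cross3 e bb a))) := by
  have hre : e 0 ^ 2 + e 1 ^ 2 + e 2 ^ 2 - (bb 0 ^ 2 + bb 1 ^ 2 + bb 2 ^ 2) = 1 := by
    have h := congrArg Complex.re hunit
    simp [Fin.sum_univ_three, hv, pow_two] at h
    linarith
  have him : e 0 * bb 0 + e 1 * bb 1 + e 2 * bb 2 = 0 := by
    have h := congrArg Complex.im hunit
    simp [Fin.sum_univ_three, hv, pow_two] at h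
    linarith
  refine ⟨?_, ?_⟩
  · intro a
    rw [QD_apply_sum lam v (fun c => ((cross3 e bb c : ℝ) : ℂ))]
    have h0 : (∑ c, v c * ((cross3 e bb c : ℝ) : ℂ)) = 0 := by
      simp only [Fin.sum_univ_three, hv, cross3_zero, cross3_one, cross3_two]
      push_cast
      ring
    rw [h0]
    ring
  · intro hb
    have hbpos := sq_pos_of_ne bb hb
    have hn : 0 < cross3 e bb 0 ^ 2 + cross3 e bb 1 ^ 2 + cross3 e bb 2 ^ 2 := by
      have h : cross3 e bb 0 ^ 2 + cross3 e bb 1 ^ 2 + cross3 e bb 2 ^ 2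
          = (e 0 ^ 2 + e 1 ^ 2 + e 2 ^ 2) * (bb 0 ^ 2 + bb 1 ^ 2 + bb 2 ^ 2)
            - (e 0 * bb 0 + e 1 * bb 1 + e 2 * bb 2) ^ 2 := by
        rw [cross3_zero, cross3_one, cross3_two]; ring
      rw [h, him]
      have he : 0 < e 0 ^ 2 + e 1 ^ 2 + e 2 ^ 2 := by linarith
      have := mul_pos he hbpos
      linarith
    refine ⟨?_, ?_⟩
    · intro h
      rw [h] at hn
      simp at hn
    · intro w μ hw hQ
      have hwpos := sq_pos_of_ne w hw
      have hQ' : ∀ a, lam * ((w a : ℂ) - 3 * v a * (∑ c, v c * (w c : ℂ))) = μ * (w a : ℂ) := by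
        intro a
        rw [← hQ a, QD_apply_sum lam v (fun c => ((w c : ℝ) : ℂ))]
      have hs : (∑ c, v c * (w c : ℂ)) = 0 := by
        by_contra hs
        generalize (∑ c, v c * (w c : ℂ)) = s at hs hQ'
        have hk : ∀ a, v a = ((lam - μ) / (3 * lam * s)) * (w a : ℂ) := by
          intro a
          field_simp
          linear_combination -(hQ' a)
        generalize (lam - μ) / (3 * lam * s) = k at hk
        have he : ∀ a, e a = k.re * w a := by
          intro a
          have h := congrArg Complex.re ((hv a).symm.trans (hk a))
          simpa using h
        have hb' : ∀ a, bb a = -k.im * w a := by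
          intro a
          have h := congrArg Complex.im ((hv a).symm.trans (hk a))
          simp at h
          linarith
        have hprod : k.re * k.im * (w 0 ^ 2 + w 1 ^ 2 + w 2 ^ 2) = 0 := by
          rw [he, he, he, hb', hb', hb'] at him
          linear_combination -him
        rcases mul_eq_zero.1 hprod with h | h
        · rcases mul_eq_zero.1 h with h | h
          · simp only [he, h] at hre
            linarith
          · apply hb
            funext a
            simp [hb', h]
        · linarith
      rw [hs] at hQ'
      have hμ : μ = lam := by
        by_contra hne
        apply hw
        funext a
        have h : (lam - μ) * (w a : ℂ) = 0 := by linear_combination hQ' a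
        rcases mul_eq_zero.1 h with h | h
        · exact absurd (sub_eq_zero.1 h).symm hne
        · exact_mod_cast h
      refine ⟨hμ, ?_⟩
      have hew : e 0 * w 0 + e 1 * w 1 + e 2 * w 2 = 0 := by
        have h := congrArg Complex.re hs
        simpa [Fin.sum_univ_three, hv] using h
      have hbw : bb 0 * w 0 + bb 1 * w 1 + bb 2 * w 2 = 0 := by
        have h := congrArg Complex.im hs
        simp [Fin.sum_univ_three, hv] at h
        linarith
      -- w × (e × b) = 0, componentwise
      have c0 : w 1 * cross3 e bb 2 = w 2 * cross3 e bb 1 := by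
        rw [cross3_one, cross3_two]
        linear_combination (e 0) * hbw - (bb 0) * hew
      have c1 : w 2 * cross3 e bb 0 = w 0 * cross3 e bb 2 := by
        rw [cross3_zero, cross3_two]
        linear_combination (e 1) * hbw - (bb 1) * hew
      have c2 : w 0 * cross3 e bb 1 = w 1 * cross3 e bb 0 := by
        rw [cross3_zero, cross3_one]
        linear_combination (e 2) * hbw - (bb 2) * hew
      refine ⟨(w 0 * cross3 e bb 0 + w 1 * cross3 e bb 1 + w 2 * cross3 e bb 2) /
        (cross3 e bb 0 ^ 2 + cross3 e bb 1 ^ 2 + cross3 e bb 2 ^ 2), ?_⟩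
      generalize cross3 e bb = n at *
      intro a
      rw [div_mul_eq_mul_div, eq_div_iff hn.ne']
      fin_cases a <;> simp only [Fin.zero_eta, Fin.mk_one, Fin.reduceFinMk]
      · linear_combination n 1 * c2 - n 2 * c1
      · linear_combination n 2 * c0 - n 0 * c2
      · linear_combination n 0 * c1 - n 1 * c0
end
end

section
/- Alignment of Poynting and super-Poynting vectors in doubly aligned non-null Einstein–Maxwell fields of Petrov type D (Eq. (3.32)). With the definitions in the context, the super-energy density is a quadratic function of the energy density, W = (ξ/2)(3(w_e/w̌)² − 1), and the super-Poynting vector is aligned with the Poynting vector: 𝒫 = (3ξ/(2w̌))·(w_e/w̌)·p. In particular, at each point and for each observer, 𝒫 is a nonnegative multiple of p. -/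
open scoped BigOperators

noncomputable section

theorem aux_trace (lam : ℂ) (v : Fin 3 → ℂ) (hunit : (∑ a, v a ^ 2) = 1) :
    Matrix.trace (QD lam v * mconj (QD lam v)) =
      ((Complex.normSq lam * (9 * (∑ a, Complex.normSq (v a)) ^ 2 - 3) : ℝ) : ℂ) := by
  have hc : (∑ a, (starRingEnd ℂ (v a)) ^ 2) = 1 := by
    have := congrArg (starRingEnd ℂ) hunit
    simpa using this
  have h3 : (starRingEnd ℂ) (3 : ℂ) = 3 := Complex.conj_ofNat 3
  push_cast
  simp only [Complex.normSq_eq_conj_mul_self]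
  simp only [Fin.sum_univ_three] at hunit hc ⊢
  simp [QD, mconj, Matrix.trace, Matrix.mul_apply, Fin.sum_univ_three, Matrix.vecMulVec_apply,
    Matrix.one_apply, h3]
  linear_combination (-3 * lam * starRingEnd ℂ lam) * hunit + (-3 * lam * starRingEnd ℂ lam) * hc

theorem aux_poynting (v : Fin 3 → ℂ) (e bb : Fin 3 → ℝ)
    (hv : ∀ a, v a = (e a : ℂ) - Complex.I * (bb a : ℂ)) (φ : ℂ) (a : Fin 3) :
    (1/(8*(Real.pi : ℂ)*Complex.I)) *
      ∑ b, ∑ c, ((eps3 a b c : ℝ) : ℂ) * (φ * v b) * starRingEnd ℂ (φ * v c) =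
    ((2 * (Complex.normSq φ / (8*Real.pi)) * cross3 e bb a : ℝ) : ℂ) := by
  have hpi : (Real.pi : ℂ) ≠ 0 := by exact_mod_cast Real.pi_ne_zero
  have key : ∑ b, ∑ c, ((eps3 a b c : ℝ) : ℂ) * (φ * v b) * starRingEnd ℂ (φ * v c) =
      2 * Complex.I * (Complex.normSq φ : ℂ) * (cross3 e bb a : ℂ) := by
    simp only [Complex.normSq_eq_conj_mul_self, hv, cross3, eps3]
    fin_cases a <;> simp [Fin.sum_univ_three] <;> ring
  rw [key]
  push_cast
  field_simp [Complex.I_ne_zero]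

/-- **Alignment of Poynting and super-Poynting vectors in doubly aligned non-null
    Einstein–Maxwell fields of Petrov type D** (Eq. (3.32)).  With Q = λ(1−3vvᵀ), λ ≠ 0,
    vᵀv = 1, v = e − ib, and f = φv (φ ≠ 0) the electromagnetic vector of the same
    observer:  the super-energy density W = ¼tr(Q·conj(Q)) satisfies
    W = (ξ/2)(3(w_e/w̌)² − 1), and the super-Poynting vector 𝒫 = (9|λ|²/2)σ(e×b) is the
    nonnegative multiple (3ξ/(2w̌))(w_e/w̌) of the Poynting vector
    p = (1/(8πi))f×conj(f). -/
theorem doubly_aligned_poynting_superPoynting_alignment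
    (lam : ℂ) (hlam : lam ≠ 0) (v : Fin 3 → ℂ) (e bb : Fin 3 → ℝ)
    (hv : ∀ a, v a = (e a : ℂ) - Complex.I * (bb a : ℂ))
    (hunit : (∑ a, v a ^ 2) = 1)
    (φ : ℂ) (hφ : φ ≠ 0) :
    let f : Fin 3 → ℂ := fun a => φ * v a
    let σ : ℝ := ∑ a, Complex.normSq (v a)
    let we : ℝ := (1/(8*Real.pi)) * ∑ a, Complex.normSq (f a)
    let wc : ℝ := Complex.normSq φ / (8*Real.pi)
    let ξ : ℝ := (3/2) * Complex.normSq lam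
    let W : ℝ := (1/4) * (Matrix.trace (QD lam v * mconj (QD lam v))).re
    let Pvec : Fin 3 → ℝ := fun a => (9 * Complex.normSq lam / 2) * σ * cross3 e bb a
    let pC : Fin 3 → ℂ := fun a => (1/(8*(Real.pi : ℂ)*Complex.I)) *
      ∑ b, ∑ c, ((eps3 a b c : ℝ) : ℂ) * f b * starRingEnd ℂ (f c)
    (W = (ξ/2) * (3*(we/wc)^2 - 1)) ∧
    (∀ a, ((Pvec a : ℝ) : ℂ) = (((3*ξ/(2*wc)) * (we/wc) : ℝ) : ℂ) * pC a) ∧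
    (∃ t : ℝ, 0 ≤ t ∧ ∀ a, ((Pvec a : ℝ) : ℂ) = ((t : ℝ) : ℂ) * pC a) := by
  intro f σ we wc ξ W Pvec pC
  have hn : 0 < Complex.normSq φ := Complex.normSq_pos.mpr hφ
  have hpi := Real.pi_pos
  have hwc : 0 < wc := by positivity
  have hr : we / wc = σ := by
    have : we = wc * σ := by
      simp only [we, wc, σ, f, Complex.normSq_mul, ← Finset.mul_sum]
      ring
    rw [this, mul_div_cancel_left₀ _ hwc.ne']
  have hσ : 0 ≤ σ := Finset.sum_nonneg fun a _ => Complex.normSq_nonneg _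
  have hξ : 0 ≤ ξ := mul_nonneg (by norm_num) (Complex.normSq_nonneg _)
  have hP : ∀ a, ((Pvec a : ℝ) : ℂ) = (((3*ξ/(2*wc)) * (we/wc) : ℝ) : ℂ) * pC a := by
    intro a
    have hp : pC a = ((2 * wc * cross3 e bb a : ℝ) : ℂ) := aux_poynting v e bb hv φ a
    rw [hp, hr, ← Complex.ofReal_mul]
    congr 1
    have hwc0 := hwc.ne'
    have : (3*ξ/(2*wc)) * σ * (2 * wc * cross3 e bb a) = 3 * ξ * σ * cross3 e bb a := by
      field_simp
    rw [this]
    simp only [Pvec, ξ]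
    ring
  refine ⟨?_, hP, (3*ξ/(2*wc)) * (we/wc), ?_, hP⟩
  · rw [hr]
    simp only [W, aux_trace lam v hunit, Complex.ofReal_re, ξ, σ]
    ring
  · rw [hr]
    positivity
end
end
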